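/- If W_i is the winning region of Player i in a Muller game (G, 𝓕₀, 𝓕₁), and W_i' is the winning region of Player i in the finite-time Muller game (G, 𝓕₀, 𝓕₁, 3) with threshold 3, then W_i = W_i' for both players i ∈ {0,1}. -/

import Mathlib

/- Common definitions for finite-time Muller games, following
   McNaughton / Fearnley-Zimmermann. -/

universe u

variable {V : Type u}

/-- The occurrence set of a finite word: the set of letters occurring in it. -/
def occ (x : List V) : Set V := {v | v ∈ x}

/-- `score F w` is the maximal `k` such that some suffix of `w` decomposes as
`x₁ ⋯ x_k` with every `xᵢ` non-empty and `occ xᵢ = F` (with `max ∅ = 0`). -/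
noncomputable def score (F : Set V) (w : List V) : ℕ :=
  sSup {k | ∃ xs : List (List V), xs.length = k ∧
    (∀ x ∈ xs, x ≠ [] ∧ occ x = F) ∧ xs.flatten <:+ w}

/-- `maxscore 𝓕 w` is the maximum of `score F u` over `F ∈ 𝓕` and non-empty
prefixes `u` of `w`. -/
noncomputable def maxscore (𝓕 : Set (Set V)) (w : List V) : ℕ :=
  sSup {n | ∃ F ∈ 𝓕, ∃ u : List V, u ≠ [] ∧ u <+: w ∧ n = score F u}

/-- `AccGood F w x` : `x` is a suffix of `w` with `occ x ⊆ F` such that removing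
any suffix `y` of `x` from `w` does not change the score of `F`. -/
def AccGood (F : Set V) (w x : List V) : Prop :=
  x <:+ w ∧ occ x ⊆ F ∧
    ∀ y : List V, y <:+ x → score F (w.take (w.length - y.length)) = score F w

/-- The accumulator `acc F w` : the occurrence set of the longest suffix `x` of `w`
with `occ x ⊆ F` such that the score of `F` did not change during `x`. -/
noncomputable def acc (F : Set V) (w : List V) : Set V :=
  occ (w.drop (sInf {i | AccGood F w (w.drop i)}))

/-- A non-empty word `w` is an `𝓕`-burden if `maxscore 𝓕 w ≤ 2` and for every
`F ∈ 𝓕` either `score F w = 0`, or `score F w = 1` and `acc F w = ∅`. -/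
def Burden (𝓕 : Set (Set V)) (w : List V) : Prop :=
  w ≠ [] ∧ maxscore 𝓕 w ≤ 2 ∧
    ∀ F ∈ 𝓕, score F w = 0 ∨ (score F w = 1 ∧ acc F w = ∅)

/-- The maxscore of an infinite sequence: the supremum (in `ℕ∞`) of the scores of
sets `F ∈ 𝓕` over all non-empty finite prefixes. -/
noncomputable def maxscoreInf (𝓕 : Set (Set V)) (ρ : ℕ → V) : ℕ∞ :=
  ⨆ F ∈ 𝓕, ⨆ n : ℕ, (score F ((List.range (n + 1)).map ρ) : ℕ∞)

/-- The set of elements occurring infinitely often in the sequence `ρ`. -/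
def limitSet (ρ : ℕ → V) : Set V := {v | ∀ N : ℕ, ∃ n, N ≤ n ∧ ρ n = v}

/-- The indicator of a play: the union of all `F ∈ 𝓕` with positive score
together with all non-empty accumulators of members of `𝓕`. -/
noncomputable def ind (𝓕 : Set (Set V)) (w : List V) : Set V :=
  (⋃ F ∈ {F ∈ 𝓕 | 0 < score F w}, F) ∪ ⋃ F ∈ {F ∈ 𝓕 | acc F w ≠ ∅}, acc F w

/-- An arena: a finite directed graph together with the set `V0` of vertices of
Player 0 (Player 1 owns the complement), where every vertex has a successor. -/
structure Arena (V : Type u) where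
  V0 : Set V
  E : V → V → Prop
  exists_succ : ∀ v, ∃ u, E v u

/-- The positions of Player `i`. -/
def Arena.pos (G : Arena V) (i : Fin 2) : Set V :=
  if i = 0 then G.V0 else G.V0ᶜ

/-- A strategy maps a history (the play so far, excluding the current vertex)
and the current vertex to a successor vertex. -/
abbrev Strategy (V : Type u) := List V → V → V

/-- A strategy is legal if it always moves along edges. -/
def Arena.Legal (G : Arena V) (σ : Strategy V) : Prop :=
  ∀ w v, G.E v (σ w v)

/-- An infinite play in `G` starting in `v`. -/
def Arena.IsPlay (G : Arena V) (v : V) (ρ : ℕ → V) : Prop :=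
  ρ 0 = v ∧ ∀ n, G.E (ρ n) (ρ (n + 1))

/-- An infinite play is consistent with the strategy `σ` of Player `i`. -/
def Arena.ConsistentInf (G : Arena V) (i : Fin 2) (σ : Strategy V) (ρ : ℕ → V) : Prop :=
  ∀ n, ρ n ∈ G.pos i → ρ (n + 1) = σ ((List.range n).map ρ) (ρ n)

/-- Player `i` (with winning condition `𝓕i`) wins the Muller game from `v`. -/
def Arena.MullerWinFrom (G : Arena V) (i : Fin 2) (𝓕i : Set (Set V)) (v : V) : Prop :=
  ∃ σ : Strategy V, G.Legal σ ∧
    ∀ ρ : ℕ → V, G.IsPlay v ρ → G.ConsistentInf i σ ρ → limitSet ρ ∈ 𝓕i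

/-- The winning region of Player `i` in the Muller game. -/
def Arena.MullerWinRegion (G : Arena V) (i : Fin 2) (𝓕i : Set (Set V)) : Set V :=
  {v | G.MullerWinFrom i 𝓕i v}

/-- A finite play is consistent with the strategy `σ` of Player `i`. -/
def Arena.ConsistentFin (G : Arena V) (i : Fin 2) (σ : Strategy V) (w : List V) : Prop :=
  ∀ (u : List V) (v x : V), u ++ [v, x] <+: w → v ∈ G.pos i → x = σ u v

/-- A play of the finite-time Muller game with threshold `k`: a finite path
whose maxscore (over all subsets) is exactly `k`, while the maxscore of
its proper prefixes is `< k`. -/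
def FTPlay (G : Arena V) (k : ℕ) (w : List V) : Prop :=
  w.Chain' G.E ∧ maxscore (Set.univ : Set (Set V)) w = k ∧
    maxscore (Set.univ : Set (Set V)) w.dropLast < k

/-- Player `i` wins the finite-time Muller game with threshold `k` from `v`. -/
def FTWinFrom (G : Arena V) (i : Fin 2) (𝓕i : Set (Set V)) (k : ℕ) (v : V) : Prop :=
  ∃ σ : Strategy V, G.Legal σ ∧
    ∀ w : List V, FTPlay G k w → w.head? = some v → G.ConsistentFin i σ w →
      ∃ F ∈ 𝓕i, score F w = k

/-- The winning region of Player `i` in the finite-time Muller game. -/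
def FTWinRegion (G : Arena V) (i : Fin 2) (𝓕i : Set (Set V)) (k : ℕ) : Set V :=
  {v | FTWinFrom G i 𝓕i k v}

/-- A play of McNaughton's finite-time Muller game: a finite path such that some
set `F` reaches score `|F|! + 1`, while no set did so in a proper prefix. -/
def McNPlay (G : Arena V) (w : List V) : Prop :=
  w.Chain' G.E ∧ (∃ F : Set V, score F w = F.ncard.factorial + 1) ∧
    ∀ u : List V, u <+: w → u ≠ w →
      ∀ F : Set V, score F u ≠ F.ncard.factorial + 1

/-- Player `i` wins McNaughton's finite-time Muller game from `v`. -/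
def McNWinFrom (G : Arena V) (i : Fin 2) (𝓕i : Set (Set V)) (v : V) : Prop :=
  ∃ σ : Strategy V, G.Legal σ ∧
    ∀ w : List V, McNPlay G w → w.head? = some v → G.ConsistentFin i σ w →
      ∃ F ∈ 𝓕i, score F w = F.ncard.factorial + 1

/-- The winning region of Player `i` in McNaughton's finite-time Muller game. -/
def McNWinRegion (G : Arena V) (i : Fin 2) (𝓕i : Set (Set V)) : Set V :=
  {v | McNWinFrom G i 𝓕i v}

open Classical in
/-- The list `ρ₀ ⋯ ρₙ` of the first `n+1` vertices of the unique play that starts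
in `v` and is consistent with the strategy `σ` of Player `i` and the strategy `τ`
of the other player. -/
noncomputable def playList (G : Arena V) (i : Fin 2) (σ τ : Strategy V) (v : V) :
    ℕ → List V
  | 0 => [v]
  | n + 1 =>
      let w := playList G i σ τ v n
      let u := w.getLastD v
      w ++ [if u ∈ G.pos i then σ w.dropLast u else τ w.dropLast u]

/-- `playOf G i σ τ v` : the unique play starting in `v` that is consistent with
the strategy `σ` of Player `i` and the strategy `τ` of the other player. -/
noncomputable def playOf (G : Arena V) (i : Fin 2) (σ τ : Strategy V) (v : V)
    (n : ℕ) : V :=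
  (playList G i σ τ v n).getLastD v

open Classical in
/-- One step of the automaton that computes the score of `F` and the set of letters seen since the
last change of this score. -/
noncomputable def scoreStep (F : Set V) (v : V) (p : ℕ × Set V) : ℕ × Set V :=
  if v ∉ F then (0, ∅)
  else if F ⊆ insert v p.2 then (p.1 + 1, ∅) else (p.1, insert v p.2)

/-- The state of the score automaton of `F` after the word whose reversal is `w`. -/
noncomputable def scoreState (F : Set V) (w : List V) : ℕ × Set V :=
  w.foldr (scoreStep F) (0, ∅)

theorem scoreState_cons (F : Set V) (v : V) (w : List V) :
    scoreState F (v :: w) = scoreStep F v (scoreState F w) := rfl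

theorem scoreStep_cases (F : Set V) (v : V) (p : ℕ × Set V) :
    (v ∉ F ∧ scoreStep F v p = (0, ∅)) ∨
    (v ∈ F ∧ F ⊆ insert v p.2 ∧ scoreStep F v p = (p.1 + 1, ∅)) ∨
    (v ∈ F ∧ ¬ F ⊆ insert v p.2 ∧ scoreStep F v p = (p.1, insert v p.2)) := by
  unfold scoreStep
  split_ifs <;> simp_all

theorem scoreStep_of_notMem {F : Set V} {v : V} (h : v ∉ F) (p : ℕ × Set V) :
    scoreStep F v p = (0, ∅) := by
  simp [scoreStep, h]

theorem scoreStep_fst_le (F : Set V) (v : V) (p : ℕ × Set V) : (scoreStep F v p).1 ≤ p.1 + 1 := by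
  rcases scoreStep_cases F v p with h | h | h <;> simp [h]

/-- The score is zero, or it is one and no letter has been seen since it changed. -/
def Fresh (p : ℕ × Set V) : Prop := p.1 = 0 ∨ p.1 = 1 ∧ p.2 = ∅

/-- Some letter of `F` outside `W` has not been seen since the last change of the score. -/
def Lacks (W F : Set V) (p : ℕ × Set V) : Prop := ∃ y ∈ F, y ∉ W ∧ y ∉ p.2

/-- The score of `F` cannot exceed `k + 1` while the play stays in `W`. -/
def Capped (k : ℕ) (W F : Set V) (p : ℕ × Set V) : Prop :=
  p.1 ≤ k ∨ p.1 = k + 1 ∧ Lacks W F p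

theorem Capped.le {k : ℕ} {W F : Set V} {p : ℕ × Set V} (h : Capped k W F p) : p.1 ≤ k + 1 := by
  rcases h with h | h <;> omega

theorem lacks_empty {W F : Set V} (hF : ¬ F ⊆ W) (n : ℕ) : Lacks W F (n, ∅) := by
  obtain ⟨y, hy, hyW⟩ := Set.not_subset.1 hF
  exact ⟨y, hy, hyW, by simp⟩

theorem Capped.step {k : ℕ} {W F : Set V} {p : ℕ × Set V} (h : Capped k W F p) (hF : ¬ F ⊆ W)
    {v : V} (hv : v ∈ W) : Capped k W F (scoreStep F v p) := by
  rcases scoreStep_cases F v p with ⟨_, e⟩ | ⟨_, hs, e⟩ | ⟨_, _, e⟩ <;> rw [e]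
  · left; simp
  · rcases h with h | ⟨_, y, hy, hyW, hyA⟩
    · rcases h.lt_or_eq with h | h
      · left; simpa using h
      · right; exact ⟨by simp [h], lacks_empty hF _⟩
    · rcases hs hy with rfl | hA
      · exact absurd hv hyW
      · exact absurd hA hyA
  · rcases h with h | ⟨h, y, hy, hyW, hyA⟩
    · left; exact h
    · right
      refine ⟨h, y, hy, hyW, ?_⟩
      rintro (rfl | hA)
      · exact hyW hv
      · exact hyA hA

theorem Fresh.capped {W F : Set V} {p : ℕ × Set V} (h : Fresh p) (hF : ¬ F ⊆ W) :
    Capped 0 W F p := by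
  rcases h with h | ⟨h, hA⟩
  · left; omega
  · right
    obtain ⟨y, hy, hyW⟩ := Set.not_subset.1 hF
    exact ⟨by simp [h], y, hy, hyW, by simp [hA]⟩

/-- Moving from a region to another one gives away at most one point of the score. -/
theorem Capped.step_of_not_subset {k : ℕ} {W U F : Set V} {p : ℕ × Set V} (h : Capped k W F p)
    (hF : ¬ F ⊆ U) (u : V) : Capped (k + 1) U F (scoreStep F u p) := by
  have hle := h.le
  rcases scoreStep_cases F u p with ⟨_, e⟩ | ⟨_, _, e⟩ | ⟨_, _, e⟩ <;> rw [e]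
  · left; simp
  · rcases hle.lt_or_eq with hl | hl
    · left; simp; omega
    · right; exact ⟨by simp [hl], lacks_empty hF _⟩
  · left; exact hle

theorem fresh_step_zero (F : Set V) (u : V) {p : ℕ × Set V} (hp : p.1 = 0) :
    Fresh (scoreStep F u p) := by
  rcases scoreStep_cases F u p with ⟨_, e⟩ | ⟨_, _, e⟩ | ⟨_, _, e⟩ <;> rw [e] <;> simp [Fresh, hp]

section Safety

variable (E : V → V → Prop) (P : Set V) (O : Set (Set V))

/-- A set of reversed plays, all ending in `W`, in which the player owning `P` can keep the play
until `T` is visited, and along which the sets of `O` inside `W` have score at most two. -/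
def SafeSet (W T : Set V) (S : Set (List V)) : Prop :=
  ∀ w ∈ S, ∃ v l, w = v :: l ∧ v ∈ W ∧ (∀ F ∈ O, F ⊆ W → (scoreState F w).1 ≤ 2) ∧
    (v ∈ P → ∃ u, E v u ∧ (u ∈ T ∨ u :: w ∈ S)) ∧
    (v ∉ P → ∀ u ∈ W ∪ T, E v u → u ∈ T ∨ u :: w ∈ S)

/-- The player owning `P` can stay in `W` until `T` is visited, keeping the scores of the sets of
`O` inside `W` at most two. -/
def Safe (W T : Set V) (w : List V) : Prop := ∃ S, SafeSet E P O W T S ∧ w ∈ S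

/-- The player owning `P` is safe in `W` until `T` is visited after every history ending in `W`
that is fresh for all sets of `O` inside `W`. -/
def Good (W T : Set V) : Prop :=
  ∀ v ∈ W, ∀ l, (∀ F ∈ O, F ⊆ W → Fresh (scoreState F (v :: l))) → Safe E P O W T (v :: l)

variable {E P O}

theorem Safe.unfold {W T : Set V} {v : V} {l : List V} (h : Safe E P O W T (v :: l)) :
    v ∈ W ∧ (∀ F ∈ O, F ⊆ W → (scoreState F (v :: l)).1 ≤ 2) ∧
    (v ∈ P → ∃ u, E v u ∧ (u ∈ T ∨ Safe E P O W T (u :: v :: l))) ∧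
    (v ∉ P → ∀ u ∈ W ∪ T, E v u → u ∈ T ∨ Safe E P O W T (u :: v :: l)) := by
  obtain ⟨S, hS, hw⟩ := h
  obtain ⟨v', l', e, h1, h2, h3, h4⟩ := hS _ hw
  obtain ⟨rfl, rfl⟩ := List.cons.inj e
  refine ⟨h1, h2, fun hp => ?_, fun hp u hu he => ?_⟩
  · obtain ⟨u, he, hu⟩ := h3 hp
    exact ⟨u, he, hu.imp_right fun h => ⟨S, hS, h⟩⟩
  · exact (h4 hp u hu he).imp_right fun h => ⟨S, hS, h⟩

theorem good_empty (T : Set V) : Good E P O ∅ T := fun _ h => absurd h (Set.notMem_empty _)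

theorem Fresh.le_two {p : ℕ × Set V} (h : Fresh p) : p.1 ≤ 2 := by
  rcases h with h | h <;> omega

theorem good_singleton {v : V} {T : Set V} (hP : v ∈ P → ∃ u ∈ T, E v u)
    (hO : v ∉ P → ∀ u ∈ {v} ∪ T, E v u → u ∈ T) : Good E P O {v} T := by
  rintro _ rfl l hl
  refine ⟨{_ :: l}, ?_, rfl⟩
  rintro _ rfl
  refine ⟨_, _, rfl, rfl, fun F hF hFW => (hl F hF hFW).le_two, fun hp => ?_, fun hp u hu he => ?_⟩
  · obtain ⟨u, hu, he⟩ := hP hp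
    exact ⟨u, he, Or.inl hu⟩
  · exact Or.inl (hO hp u hu he)

theorem Good.mono_exit {W T T' : Set V} (h : Good E P O W T) (hT : T ⊆ T') :
    Good E P O W T' := by
  intro v hv l hl
  obtain ⟨S, hS, hw⟩ := h v hv l hl
  refine ⟨S, fun w hw => ?_, hw⟩
  obtain ⟨v, l, e, h1, h2, h3, h4⟩ := hS w hw
  refine ⟨v, l, e, h1, h2, fun hp => ?_, fun hp u hu he => ?_⟩
  · obtain ⟨u, he, hu⟩ := h3 hp
    exact ⟨u, he, hu.imp_left fun h => hT h⟩
  · rcases hu with hu | hu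
    · exact (h4 hp u (Or.inl hu) he).imp_left fun h => hT h
    · exact Or.inl hu

theorem Good.layer {W U T : Set V} (hW : Good E P O W (U ∪ T)) (hU : Good E P O U T)
    (hd : Disjoint W U) (htrap : ∀ v ∈ U, v ∉ P → ∀ u ∈ W, E v u → u ∈ U ∪ T) :
    Good E P O (W ∪ U) T := by
  have key : SafeSet E P O (W ∪ U) T
      ({w | Safe E P O W (U ∪ T) w ∧
          ∀ F ∈ O, F ⊆ W ∪ U → ¬ F ⊆ W → Capped 0 W F (scoreState F w)} ∪
        {w | Safe E P O U T w ∧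
          ∀ F ∈ O, F ⊆ W ∪ U → ¬ F ⊆ U → Capped 1 U F (scoreState F w)}) := by
    rintro w (⟨hs, hc⟩ | ⟨hs, hc⟩)
    · obtain ⟨v, l, rfl⟩ : ∃ v l, w = v :: l := by
        obtain ⟨S, hS, hw⟩ := hs
        obtain ⟨v, l, e, _⟩ := hS w hw
        exact ⟨v, l, e⟩
      obtain ⟨hv, h2, h3, h4⟩ := hs.unfold
      have next : ∀ u, (u ∈ U ∪ T ∨ Safe E P O W (U ∪ T) (u :: v :: l)) →
          u ∈ T ∨ u :: v :: l ∈ ({w | Safe E P O W (U ∪ T) w ∧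
          ∀ F ∈ O, F ⊆ W ∪ U → ¬ F ⊆ W → Capped 0 W F (scoreState F w)} ∪
        {w | Safe E P O U T w ∧
          ∀ F ∈ O, F ⊆ W ∪ U → ¬ F ⊆ U → Capped 1 U F (scoreState F w)} : Set (List V)) := by
        rintro u ((hu | hu) | hu)
        · refine Or.inr (Or.inr ⟨hU u hu _ fun F _ hFU => ?_, fun F hF hFWU hFU => ?_⟩)
          · have : v ∉ F := fun h => Set.disjoint_left.1 hd hv (hFU h)
            rw [scoreState_cons, scoreState_cons, scoreStep_of_notMem this]
            exact fresh_step_zero _ _ rfl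
          · by_cases hFW : F ⊆ W
            · have : u ∉ F := fun h => Set.disjoint_left.1 hd (hFW h) hu
              rw [scoreState_cons, scoreStep_of_notMem this]
              left; simp
            · exact (hc F hF hFWU hFW).step_of_not_subset hFU u
        · exact Or.inl hu
        · exact Or.inr (Or.inl ⟨hu, fun F hF hFWU hFW =>
            (hc F hF hFWU hFW).step hFW hu.unfold.1⟩)
      refine ⟨v, l, rfl, Or.inl hv, fun F hF hFWU => ?_, fun hp => ?_, fun hp u hu he => ?_⟩
      · by_cases hFW : F ⊆ W
        · exact h2 F hF hFW
        · exact (hc F hF hFWU hFW).le.trans (by norm_num)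
      · obtain ⟨u, he, hu⟩ := h3 hp
        exact ⟨u, he, next u hu⟩
      · exact next u (h4 hp u (by rwa [← Set.union_assoc]) he)
    · obtain ⟨v, l, rfl⟩ : ∃ v l, w = v :: l := by
        obtain ⟨S, hS, hw⟩ := hs
        obtain ⟨v, l, e, _⟩ := hS w hw
        exact ⟨v, l, e⟩
      obtain ⟨hv, h2, h3, h4⟩ := hs.unfold
      have next : ∀ u, Safe E P O U T (u :: v :: l) →
          Safe E P O U T (u :: v :: l) ∧
          ∀ F ∈ O, F ⊆ W ∪ U → ¬ F ⊆ U → Capped 1 U F (scoreState F (u :: v :: l)) :=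
        fun u hu => ⟨hu, fun F hF hFWU hFU => (hc F hF hFWU hFU).step hFU hu.unfold.1⟩
      refine ⟨v, l, rfl, Or.inr hv, fun F hF hFWU => ?_, fun hp => ?_, fun hp u hu he => ?_⟩
      · by_cases hFU : F ⊆ U
        · exact h2 F hF hFU
        · exact (hc F hF hFWU hFU).le
      · obtain ⟨u, he, hu⟩ := h3 hp
        exact ⟨u, he, hu.imp_right fun h => Or.inr (next u h)⟩
      · have hu' : u ∈ U ∪ T := by
          rcases hu with (hu | hu) | hu
          · exact htrap v hv hp u hu he
          · exact Or.inl hu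
          · exact Or.inr hu
        exact (h4 hp u hu' he).imp_right fun h => Or.inr (next u h)
  intro v hv l hl
  refine ⟨_, key, ?_⟩
  rcases hv with hv | hv
  · exact Or.inl ⟨hW v hv l fun F hF hFW => hl F hF (hFW.trans Set.subset_union_left),
      fun F hF hFWU hFW => (hl F hF hFWU).capped hFW⟩
  · refine Or.inr ⟨hU v hv l fun F hF hFU => hl F hF (hFU.trans Set.subset_union_right),
      fun F hF hFWU hFU => Or.inl ?_⟩
    rcases hl F hF hFWU with h | h <;> omega

theorem scoreState_snd_subset (F : Set V) (w : List V) : (scoreState F w).2 ⊆ F := by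
  induction w with
  | nil => simp [scoreState]
  | cons v w ih =>
    rw [scoreState_cons]
    rcases scoreStep_cases F v (scoreState F w) with ⟨_, e⟩ | ⟨_, _, e⟩ | ⟨hv, _, e⟩ <;> rw [e]
    · simp
    · simp
    · exact Set.insert_subset hv ih

theorem occ_cons (v : V) (l : List V) : occ (v :: l) = insert v (occ l) := by
  ext; simp [occ]

theorem scoreState_snd_eq_occ (F : Set V) (w : List V) :
    ∃ n, (scoreState F w).2 = occ (w.take n) := by
  induction w with
  | nil => exact ⟨0, by simp [scoreState, occ]⟩
  | cons v w ih =>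
    rw [scoreState_cons]
    obtain ⟨n, hn⟩ := ih
    rcases scoreStep_cases F v (scoreState F w) with ⟨_, e⟩ | ⟨_, _, e⟩ | ⟨_, _, e⟩ <;> rw [e]
    · exact ⟨0, by simp [occ]⟩
    · exact ⟨0, by simp [occ]⟩
    · exact ⟨n + 1, by simp [occ_cons, hn]⟩

theorem eq_occ_of_scoreState_pos (F : Set V) (w : List V) :
    0 < (scoreState F w).1 → ∃ n, F = occ (w.take n) := by
  induction w with
  | nil => simp [scoreState]
  | cons v w ih =>
    rw [scoreState_cons]
    rcases scoreStep_cases F v (scoreState F w) with ⟨_, e⟩ | ⟨hv, hs, e⟩ | ⟨hv, _, e⟩ <;> rw [e]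
    · simp
    · intro _
      obtain ⟨n, hn⟩ := scoreState_snd_eq_occ F w
      refine ⟨n + 1, ?_⟩
      rw [List.take_succ_cons, occ_cons, ← hn]
      exact hs.antisymm (Set.insert_subset hv (scoreState_snd_subset F w))
    · intro h
      obtain ⟨n, hn⟩ := ih h
      refine ⟨n + 1, ?_⟩
      rw [List.take_succ_cons, occ_cons, ← hn, Set.insert_eq_of_mem hv]

/-- The sets with positive score and the accumulators of a history do not cover a set that is not
itself in `O`, since they form a chain. -/
theorem exists_notMem_indicator [Finite V] {O : Set (Set V)} {X : Set V} (hX : X.Nonempty)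
    (hXO : X ∉ O) (w : List V) :
    ∃ x ∈ X, ∀ F ∈ O, F ⊆ X →
      (0 < (scoreState F w).1 → x ∉ F) ∧ x ∉ (scoreState F w).2 := by
  by_contra! hcon
  let M : Set (Set V) := {A | ∃ F ∈ O, F ⊆ X ∧
    (0 < (scoreState F w).1 ∧ A = F ∨ A = (scoreState F w).2)}
  have hcov : ∀ x ∈ X, ∃ A ∈ M, x ∈ A := by
    intro x hx
    obtain ⟨F, hF, hFX, h⟩ := hcon x hx
    by_cases h' : 0 < (scoreState F w).1 ∧ x ∈ F
    · exact ⟨F, ⟨F, hF, hFX, Or.inl ⟨h'.1, rfl⟩⟩, h'.2⟩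
    · exact ⟨_, ⟨F, hF, hFX, Or.inr rfl⟩, h fun h1 h2 => h' ⟨h1, h2⟩⟩
  have hocc : ∀ A ∈ M, ∃ n, A = occ (w.take n) := by
    rintro A ⟨F, _, _, ⟨hp, rfl⟩ | rfl⟩
    · exact eq_occ_of_scoreState_pos _ w hp
    · exact scoreState_snd_eq_occ F w
  have hne : ∀ A ∈ M, ¬ X ⊆ A := by
    rintro A ⟨F, hF, hFX, ⟨_, rfl⟩ | rfl⟩ hXA
    · exact hXO (hXA.antisymm hFX ▸ hF)
    · exact hXO ((hXA.trans (scoreState_snd_subset F w)).antisymm hFX ▸ hF)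
  obtain ⟨x, hx⟩ := hX
  obtain ⟨A, hA, _⟩ := hcov x hx
  obtain ⟨A, hA⟩ := (Set.toFinite M).exists_maximal ⟨A, hA⟩
  refine hne A hA.prop fun y hy => ?_
  obtain ⟨B, hB, hyB⟩ := hcov y hy
  obtain ⟨m, rfl⟩ := hocc A hA.prop
  obtain ⟨n, rfl⟩ := hocc B hB
  rcases le_total m n with h | h
  · exact hA.le_of_ge hB (fun z hz => (List.take_prefix_take_left h).subset hz) hyB
  · exact (List.take_prefix_take_left h).subset hyB

theorem good_of_forall_exit [Finite V] {X : Set V} (hX : ∀ v ∈ X, ∃ u ∈ X, E v u) (hXO : X ∉ O)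
    (hT : ∀ T ⊆ X, T.Nonempty → Good E P O (X \ T) T) : Good E P O X ∅ := by
  let B : Set (List V) :=
    {w | ∃ v ∈ X, ∃ l, w = v :: l ∧ ∀ F ∈ O, F ⊆ X → Fresh (scoreState F w)}
  let Z : Set (List V) := {w | ∃ T ⊆ X, Safe E P O (X \ T) T w ∧
    ∀ F ∈ O, F ⊆ X → ¬ Disjoint F T → (scoreState F w).1 = 0 ∧ Disjoint (scoreState F w).2 T}
  let Step (v : V) (w : List V) (S : Set (List V)) : Prop :=
    v ∈ X ∧ (∀ F ∈ O, F ⊆ X → (scoreState F w).1 ≤ 2) ∧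
    (v ∈ P → ∃ u, E v u ∧ u :: w ∈ S) ∧ (v ∉ P → ∀ u ∈ X, E v u → u :: w ∈ S)
  have hZ : ∀ v l, v :: l ∈ Z → Step v (v :: l) (Z ∪ B) := by
    rintro v l ⟨T, hTX, hs, hc⟩
    obtain ⟨hv, h2, h3, h4⟩ := hs.unfold
    have next : ∀ u, (u ∈ T ∨ Safe E P O (X \ T) T (u :: v :: l)) → u :: v :: l ∈ Z ∪ B := by
      rintro u (hu | hu)
      · refine Or.inr ⟨u, hTX hu, _, rfl, fun F hF hFX => ?_⟩
        by_cases hd : Disjoint F T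
        · rw [scoreState_cons, scoreStep_of_notMem fun h => Set.disjoint_left.1 hd h hu]
          exact Or.inl rfl
        · exact fresh_step_zero _ _ (hc F hF hFX hd).1
      · refine Or.inl ⟨T, hTX, hu, fun F hF hFX hd => ?_⟩
        obtain ⟨h0, hA⟩ := hc F hF hFX hd
        rw [scoreState_cons]
        have huT := hu.unfold.1.2
        rcases scoreStep_cases F u (scoreState F (v :: l)) with
          ⟨_, e⟩ | ⟨_, hs, e⟩ | ⟨_, _, e⟩ <;> rw [e]
        · simp
        · refine absurd (Disjoint.mono_left hs ?_) hd
          rw [Set.disjoint_insert_left]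
          exact ⟨huT, hA⟩
        · exact ⟨h0, Set.disjoint_insert_left.2 ⟨huT, hA⟩⟩
    refine ⟨hv.1, fun F hF hFX => ?_, fun hp => ?_, fun hp u hu he => ?_⟩
    · by_cases hd : Disjoint F T
      · exact h2 F hF (Set.subset_sdiff.2 ⟨hFX, hd⟩)
      · rw [(hc F hF hFX hd).1]; norm_num
    · obtain ⟨u, he, hu⟩ := h3 hp
      exact ⟨u, he, next u hu⟩
    · refine next u (h4 hp u ?_ he)
      by_cases h : u ∈ T
      · exact Or.inr h
      · exact Or.inl ⟨hu, h⟩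
  have hB : ∀ v l, v :: l ∈ B → Step v (v :: l) (Z ∪ B) := by
    rintro v l ⟨_, hv, _, e, hl⟩
    obtain ⟨rfl, rfl⟩ := List.cons.inj e
    let T : Set V := {x ∈ X | ∀ F ∈ O, F ⊆ X →
      (0 < (scoreState F (v :: l)).1 → x ∉ F) ∧ x ∉ (scoreState F (v :: l)).2}
    have hTne : T.Nonempty := exists_notMem_indicator ⟨v, hv⟩ hXO (v :: l)
    have hTX : T ⊆ X := Set.sep_subset _ _
    by_cases hvT : v ∈ T
    · have h0 : ∀ F ∈ O, F ⊆ X → (scoreState F (v :: l)).1 = 0 := by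
        intro F hF hFX
        obtain ⟨h1, h2⟩ := hvT.2 F hF hFX
        by_contra hne
        have hvF := h1 (Nat.pos_of_ne_zero hne)
        rw [scoreState_cons, scoreStep_of_notMem hvF] at hne
        exact hne rfl
      have next : ∀ u ∈ X, u :: v :: l ∈ Z ∪ B := fun u hu =>
        Or.inr ⟨u, hu, _, rfl, fun F hF hFX => fresh_step_zero _ _ (h0 F hF hFX)⟩
      refine ⟨hv, fun F hF hFX => (hl F hF hFX).le_two, fun _ => ?_, fun _ u hu _ => next u hu⟩
      obtain ⟨u, hu, he⟩ := hX v hv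
      exact ⟨u, he, next u hu⟩
    · refine hZ v l ⟨T, hTX, hT T hTX hTne v ⟨hv, hvT⟩ l
        fun F hF hF' => hl F hF (hF'.trans Set.sdiff_subset), fun F hF hFX hd => ?_⟩
      obtain ⟨t, htF, htT⟩ := Set.not_disjoint_iff.1 hd
      refine ⟨?_, Set.disjoint_left.2 fun x hx hxT => (hxT.2 F hF hFX).2 hx⟩
      by_contra hne
      exact (htT.2 F hF hFX).1 (Nat.pos_of_ne_zero hne) htF
  intro v hv l hl
  refine ⟨Z ∪ B, ?_, Or.inr ⟨v, hv, l, rfl, hl⟩⟩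
  rintro w hw
  obtain ⟨v, l, rfl⟩ : ∃ v l, w = v :: l := by
    rcases hw with ⟨T, _, ⟨S, hS, hw⟩, _⟩ | ⟨v, _, l, e, _⟩
    · obtain ⟨v, l, e, _⟩ := hS w hw
      exact ⟨v, l, e⟩
    · exact ⟨v, l, e⟩
  obtain ⟨h1, h2, h3, h4⟩ := hw.elim (hZ v l) (hB v l)
  refine ⟨v, l, rfl, h1, h2, fun hp => ?_, fun hp u hu he => ?_⟩
  · obtain ⟨u, he, hu⟩ := h3 hp
    exact ⟨u, he, Or.inr hu⟩
  · exact Or.inr (h4 hp u (by simpa using hu) he)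

variable (E P O) in
/-- `U` is a maximal good region from which the opponent can leave only to `T`. -/
structure MaxGood (X T U : Set V) : Prop where
  subset : U ⊆ X \ T
  good : Good E P O U T
  trap : ∀ v ∈ U, v ∉ P → ∀ u ∈ X, E v u → u ∈ U ∪ T
  max : ∀ W ⊆ X \ (U ∪ T), Good E P O W (U ∪ T) →
    (∀ v ∈ W, v ∉ P → ∀ u ∈ X, E v u → u ∈ W ∪ (U ∪ T)) → W = ∅

theorem exists_maxGood [Finite V] (X T : Set V) : ∃ U, MaxGood E P O X T U := by
  obtain ⟨U, hU⟩ := (Set.toFinite {U | U ⊆ X \ T ∧ Good E P O U T ∧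
    ∀ v ∈ U, v ∉ P → ∀ u ∈ X, E v u → u ∈ U ∪ T}).exists_maximal
    ⟨∅, by simp, good_empty T, by simp⟩
  obtain ⟨hUX, hg, htrap⟩ := hU.prop
  refine ⟨U, hUX, hg, htrap, fun W hWX hW hWtrap => ?_⟩
  have hd : Disjoint W U := Set.disjoint_left.2 fun x hx hxU => (hWX hx).2 (Or.inl hxU)
  have hmem : W ∪ U ∈ {U | U ⊆ X \ T ∧ Good E P O U T ∧
      ∀ v ∈ U, v ∉ P → ∀ u ∈ X, E v u → u ∈ U ∪ T} := by
    refine ⟨Set.union_subset (fun x hx => ⟨(hWX hx).1, fun h => (hWX hx).2 (Or.inr h)⟩) hUX,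
      hW.layer hg hd fun v hv hp u hu he => htrap v hv hp u (hWX hu).1 he, ?_⟩
    rintro v (hv | hv) hp u hu he
    · rw [Set.union_assoc]
      exact hWtrap v hv hp u hu he
    · rw [Set.union_assoc]
      exact Or.inr (htrap v hv hp u hu he)
  have hWU : W ⊆ U := Set.subset_union_left.trans (hU.le_of_ge hmem Set.subset_union_right)
  exact Set.eq_empty_of_forall_notMem fun x hx => Set.disjoint_left.1 hd hx (hWU hx)

theorem MaxGood.no_edge {X T U : Set V} (h : MaxGood E P O X T U) {v u : V}
    (hv : v ∈ X \ (U ∪ T)) (hp : v ∈ P) (hu : u ∈ U ∪ T) : ¬ E v u := by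
  intro he
  refine Set.singleton_ne_empty v (h.max {v} (by simpa using hv)
    (good_singleton (fun _ => ⟨u, hu, he⟩) fun hp' => absurd hp hp') ?_)
  rintro _ rfl hp'
  exact absurd hp hp'

theorem MaxGood.exists_succ {X T U : Set V} (h : MaxGood E P O X T U)
    (hX : ∀ v ∈ X, ∃ u ∈ X, E v u) : ∀ v ∈ X \ (U ∪ T), ∃ u ∈ X \ (U ∪ T), E v u := by
  intro v hv
  by_contra! hcon
  by_cases hp : v ∈ P
  · obtain ⟨u, hu, he⟩ := hX v hv.1
    exact hcon u ⟨hu, fun huR => h.no_edge hv hp huR he⟩ he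
  · have hall : ∀ u ∈ X, E v u → u ∈ U ∪ T := fun u hu he =>
      by_contra fun hR => hcon u ⟨hu, hR⟩ he
    refine Set.singleton_ne_empty v (h.max {v} (by simpa using hv)
      (good_singleton (fun hp' => absurd hp' hp) ?_) ?_)
    · rintro _ u (rfl | hu) he
      · exact hall _ hv.1 he
      · exact hu
    · rintro _ rfl _ u hu he
      exact Or.inr (hall u hu he)

variable (E P O) in
/-- The subgame on `X` is covered by good regions of the two players that are traps for the
respective opponents. -/
def Split (O' : Set (Set V)) (X : Set V) : Prop :=
  ∃ D D', D ∪ D' = X ∧ Good E P O D ∅ ∧ Good E Pᶜ O' D' ∅ ∧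
    (∀ v ∈ D, v ∉ P → ∀ u ∈ X, E v u → u ∈ D) ∧
    (∀ v ∈ D', v ∈ P → ∀ u ∈ X, E v u → u ∈ D')

theorem Split.symm {O' : Set (Set V)} {X : Set V} (h : Split E Pᶜ O' O X) : Split E P O O' X := by
  obtain ⟨D, D', h1, h2, h3, h4, h5⟩ := h
  rw [compl_compl] at h3
  exact ⟨D', D, by rw [Set.union_comm, h1], h3, h2, fun v hv hp => h5 v hv hp,
    fun v hv hp => h4 v hv fun h => h hp⟩

theorem split_of_notMem [Finite V] {O' : Set (Set V)} {X : Set V}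
    (hX : ∀ v ∈ X, ∃ u ∈ X, E v u) (hXO : X ∉ O)
    (ih : ∀ Y, Y ⊂ X → (∀ v ∈ Y, ∃ u ∈ Y, E v u) → Split E P O O' Y) : Split E P O O' X := by
  obtain ⟨U, hU⟩ := exists_maxGood (E := E) (P := Pᶜ) (O := O') X ∅
  have hUX : U ⊆ X := hU.subset.trans Set.sdiff_subset
  rcases U.eq_empty_or_nonempty with rfl | ⟨x, hx⟩
  · refine ⟨X, ∅, by simp, good_of_forall_exit hX hXO fun T hTX ⟨t, ht⟩ => ?_, good_empty _,
      fun _ _ _ u hu _ => hu, by simp⟩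
    obtain ⟨R, hR⟩ := exists_maxGood (E := E) (P := P) (O := O) X T
    obtain ⟨D, D', hDD, hD, hD', -, hD't⟩ := ih (X \ (R ∪ T))
      ⟨Set.sdiff_subset, fun h => (h (hTX ht)).2 (Or.inr ht)⟩ (hR.exists_succ hX)
    have hD'X : D' ⊆ X \ (R ∪ T) := hDD ▸ Set.subset_union_right
    have hD'e : D' = ∅ := by
      refine hU.max D' (by simpa using hD'X.trans Set.sdiff_subset) (by simpa using hD')
        fun v hv hp u hu he => Or.inl ?_
      have hp' : v ∈ P := not_not.1 hp
      exact hD't v hv hp' u ⟨hu, fun h => hR.no_edge (hD'X hv) hp' h he⟩ he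
    rw [hD'e, Set.union_empty] at hDD
    subst hDD
    have he := hR.max _ le_rfl (hD.mono_exit (Set.empty_subset _)) fun v _ _ u hu _ => by
      by_cases h : u ∈ R ∪ T
      · exact Or.inr h
      · exact Or.inl ⟨hu, h⟩
    have : X \ T = R := by
      refine Set.Subset.antisymm (fun y hy => ?_) hR.subset
      rcases Set.sdiff_eq_empty.1 he hy.1 with h | h
      · exact h
      · exact absurd h hy.2
    rw [this]
    exact hR.good
  · obtain ⟨D, D', hDD, hD, hD', -, hD't⟩ := ih (X \ (U ∪ ∅))
      ⟨Set.sdiff_subset, fun h => (h (hUX hx)).2 (Or.inl hx)⟩ (hU.exists_succ hX)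
    have hD'X : D' ⊆ X \ (U ∪ ∅) := hDD ▸ Set.subset_union_right
    have hD'e : D' = ∅ := by
      refine hU.max D' hD'X (hD'.mono_exit (Set.empty_subset _)) fun v hv hp u hu he => ?_
      by_cases h : u ∈ U ∪ ∅
      · exact Or.inr h
      · exact Or.inl (hD't v hv (not_not.1 hp) u ⟨hu, h⟩ he)
    rw [hD'e, Set.union_empty] at hDD
    refine ⟨D, U, ?_, hD, hU.good, fun v hv hp u hu he => ?_, fun v hv hp u hu he => ?_⟩
    · rw [hDD, Set.union_empty, Set.sdiff_union_of_subset hUX]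
    · rw [hDD] at hv ⊢
      exact ⟨hu, fun h => hU.no_edge hv hp h he⟩
    · simpa using hU.trap v hv (fun h => h hp) u hu he

theorem split_of_disjoint [Finite V] {O' : Set (Set V)} (hO : Disjoint O O') (X : Set V)
    (hX : ∀ v ∈ X, ∃ u ∈ X, E v u) : Split E P O O' X := by
  induction X using WellFoundedLT.induction with
  | ind X ih =>
  by_cases h : X ∈ O
  · refine Split.symm (split_of_notMem hX (Set.disjoint_left.1 hO h) fun Y hY hYs => ?_)
    refine Split.symm ?_
    rw [compl_compl]
    exact ih Y hY hYs
  · exact split_of_notMem hX h fun Y hY hYs => ih Y hY hYs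

end Safety

section Score

theorem scoreState_append {F : Set V} (r l : List V) (hl : occ l ⊆ F) :
    (scoreState F r).1 < (scoreState F (l ++ r)).1 ∨
      (scoreState F (l ++ r)).1 = (scoreState F r).1 ∧
        (scoreState F (l ++ r)).2 = occ l ∪ (scoreState F r).2 ∧
        (l ≠ [] → ¬ F ⊆ (scoreState F (l ++ r)).2) := by
  induction l with
  | nil => right; simp [occ]
  | cons v l ih =>
    rw [occ_cons, Set.insert_subset_iff] at hl
    rw [List.cons_append, scoreState_cons]
    have ih := ih hl.2
    rcases scoreStep_cases F v (scoreState F (l ++ r)) with ⟨h, _⟩ | ⟨_, _, e⟩ | ⟨_, hs, e⟩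
    · exact absurd hl.1 h
    · rw [e]
      left
      change _ < (scoreState F (l ++ r)).1 + 1
      rcases ih with h | h <;> omega
    · rw [e]
      refine ih.imp id fun h => ⟨h.1, ?_, fun _ => hs⟩
      rw [occ_cons, h.2.1, Set.insert_union]

theorem scoreState_lt_append {F : Set V} (r l : List V) (hl : occ l = F) (hne : l ≠ []) :
    (scoreState F r).1 < (scoreState F (l ++ r)).1 := by
  rcases scoreState_append r l hl.le with h | ⟨_, h1, h2⟩
  · exact h
  · refine absurd ?_ (h2 hne)
    rw [h1, hl]
    exact Set.subset_union_left

theorem occ_reverse (l : List V) : occ l.reverse = occ l := by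
  ext; simp [occ]

theorem occ_append (l r : List V) : occ (l ++ r) = occ l ∪ occ r := by
  ext; simp [occ]

theorem occ_append_singleton (l : List V) (v : V) : occ (l ++ [v]) = insert v (occ l) := by
  ext; simp [occ, or_comm]

theorem length_le_scoreState {F : Set V} (p : List V) (xs : List (List V))
    (h : ∀ x ∈ xs, x ≠ [] ∧ occ x = F) :
    xs.length ≤ (scoreState F (p ++ xs.flatten).reverse).1 := by
  induction xs using List.reverseRecOn with
  | nil => simp
  | append_singleton xs x ih =>
    have ih := ih fun y hy => h y (by simp [hy])
    obtain ⟨hne, hx⟩ := h x (by simp)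
    have := scoreState_lt_append (p ++ xs.flatten).reverse x.reverse
      ((occ_reverse x).trans hx) (by simpa using hne)
    have e : (p ++ (xs ++ [x]).flatten).reverse = x.reverse ++ (p ++ xs.flatten).reverse := by simp
    rw [e, List.length_append, List.length_singleton]
    omega

theorem exists_blocks (F : Set V) (w : List V) :
    ∃ (xs : List (List V)) (y : List V), xs.length = (scoreState F w.reverse).1 ∧
      (∀ x ∈ xs, x ≠ [] ∧ occ x = F) ∧ xs.flatten ++ y <:+ w ∧
      occ y = (scoreState F w.reverse).2 := by
  induction w using List.reverseRecOn with
  | nil => exact ⟨[], [], by simp [scoreState, occ]⟩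
  | append_singleton w v ih =>
    obtain ⟨xs, y, h1, h2, ⟨p, hp⟩, h4⟩ := ih
    rw [List.reverse_append, List.reverse_singleton, List.singleton_append, scoreState_cons]
    rcases scoreStep_cases F v (scoreState F w.reverse) with ⟨_, e⟩ | ⟨hv, hs, e⟩ | ⟨_, _, e⟩ <;>
      rw [e]
    · exact ⟨[], [], by simp [occ]⟩
    · refine ⟨xs ++ [y ++ [v]], [], by simp [h1], ?_, ⟨p, by simp [← hp]⟩, by simp [occ]⟩
      intro x hx
      rcases List.mem_append.1 hx with hx | hx
      · exact h2 x hx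
      · rw [List.mem_singleton.1 hx]
        refine ⟨by simp, Set.Subset.antisymm ?_ ?_⟩
        · rw [occ_append_singleton, h4]
          exact Set.insert_subset hv (scoreState_snd_subset F _)
        · rw [occ_append_singleton, h4]
          exact hs
    · refine ⟨xs, y ++ [v], h1, h2, ⟨p, by simp [← hp]⟩, ?_⟩
      rw [occ_append_singleton, h4]

theorem score_eq_scoreState (F : Set V) (w : List V) : score F w = (scoreState F w.reverse).1 := by
  refine IsGreatest.csSup_eq ⟨?_, ?_⟩
  · obtain ⟨xs, y, h1, h2, h3, h4⟩ := exists_blocks F w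
    rcases xs.eq_nil_or_concat with rfl | ⟨ys, z, rfl⟩
    · exact ⟨[], h1, by simp, by simp⟩
    · refine ⟨ys ++ [z ++ y], by simpa using h1, fun x hx => ?_, by simpa using h3⟩
      rcases List.mem_append.1 hx with hx | hx
      · exact h2 x (by simp [hx])
      · obtain ⟨hz, hzF⟩ := h2 z (by simp)
        rw [List.mem_singleton.1 hx]
        refine ⟨by simp [hz], ?_⟩
        rw [occ_append, hzF, h4]
        exact Set.union_eq_left.2 (scoreState_snd_subset F _)
  · rintro k ⟨xs, rfl, h, p, rfl⟩
    exact length_le_scoreState p xs h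

theorem score_append_singleton_le (F : Set V) (w : List V) (v : V) :
    score F (w ++ [v]) ≤ score F w + 1 := by
  rw [score_eq_scoreState, score_eq_scoreState, List.reverse_append, List.reverse_singleton,
    List.singleton_append, scoreState_cons]
  exact scoreStep_fst_le _ _ _

theorem score_nil (F : Set V) : score F [] = 0 := by
  rw [score_eq_scoreState]; rfl

theorem score_le_length (F : Set V) (w : List V) : score F w ≤ w.length := by
  induction w using List.reverseRecOn with
  | nil => rw [score_nil]; simp
  | append_singleton w v ih =>
    have := score_append_singleton_le F w v
    simp only [List.length_append, List.length_singleton]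
    omega

theorem score_le_maxscore {𝓕 : Set (Set V)} {F : Set V} (hF : F ∈ 𝓕) {u w : List V} (hu : u ≠ [])
    (h : u <+: w) : score F u ≤ maxscore 𝓕 w := by
  refine le_csSup ⟨w.length, ?_⟩ ⟨F, hF, u, hu, h, rfl⟩
  rintro _ ⟨F, _, u, _, h, rfl⟩
  exact (score_le_length F u).trans h.length_le

theorem maxscore_le {𝓕 : Set (Set V)} {w : List V} {k : ℕ}
    (h : ∀ F ∈ 𝓕, ∀ u, u <+: w → score F u ≤ k) : maxscore 𝓕 w ≤ k := by
  refine csSup_le' ?_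
  rintro _ ⟨F, hF, u, _, hu, rfl⟩
  exact h F hF u hu

theorem exists_score_eq_maxscore {𝓕 : Set (Set V)} {w : List V} (h : 0 < maxscore 𝓕 w) :
    ∃ F ∈ 𝓕, ∃ u, u ≠ [] ∧ u <+: w ∧ maxscore 𝓕 w = score F u := by
  refine Nat.sSup_mem (s := {n | ∃ F ∈ 𝓕, ∃ u : List V, u ≠ [] ∧ u <+: w ∧ n = score F u}) ?_
    ⟨w.length, ?_⟩
  · by_contra hne
    rw [Set.not_nonempty_iff_eq_empty] at hne
    rw [maxscore, hne] at h
    simp at h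
  · rintro _ ⟨F, _, u, _, h, rfl⟩
    exact (score_le_length F u).trans h.length_le

/-- The limit set of an infinite sequence reaches arbitrarily high scores. -/
theorem exists_le_score_limitSet [Finite V] (ρ : ℕ → V) (k : ℕ) :
    ∃ n, k ≤ score (limitSet ρ) ((List.range n).map ρ) := by
  cases nonempty_fintype V
  obtain ⟨N, hN⟩ : ∃ N, ∀ n ≥ N, ρ n ∈ limitSet ρ := by
    have : ∀ v, ∃ N, v ∉ limitSet ρ → ∀ n ≥ N, ρ n ≠ v := by
      intro v
      by_cases hv : v ∈ limitSet ρ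
      · exact ⟨0, fun h => absurd hv h⟩
      · simp only [limitSet, Set.mem_ofPred_eq, not_forall, not_exists, not_and] at hv
        obtain ⟨N, hN⟩ := hv
        exact ⟨N, fun _ n hn => hN n hn⟩
    choose f hf using this
    refine ⟨Finset.univ.sup f, fun n hn => by_contra fun h => ?_⟩
    exact hf _ h n ((Finset.le_sup (Finset.mem_univ (ρ n))).trans hn) rfl
  suffices ∃ n ≥ N, k ≤ score (limitSet ρ) ((List.range n).map ρ) from this.imp fun n h => h.2
  induction k with
  | zero => exact ⟨N, le_rfl, Nat.zero_le _⟩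
  | succ k ih =>
    obtain ⟨n, hn, hk⟩ := ih
    have : ∀ v, ∃ m, v ∈ limitSet ρ → n ≤ m ∧ ρ m = v := by
      intro v
      by_cases hv : v ∈ limitSet ρ
      · obtain ⟨m, hm⟩ := hv n
        exact ⟨m, fun _ => hm⟩
      · exact ⟨0, fun h => absurd h hv⟩
    choose f hf using this
    let d := Finset.univ.sup f + 1
    let l := (List.range d).map fun i => ρ (n + i)
    have hocc : occ l = limitSet ρ := by
      ext v
      constructor
      · intro hv
        obtain ⟨i, _, rfl⟩ := List.mem_map.1 hv
        exact hN _ (by omega)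
      · intro hv
        obtain ⟨h1, h2⟩ := hf v hv
        have h3 : f v ≤ Finset.univ.sup f := Finset.le_sup (Finset.mem_univ v)
        refine List.mem_map.2 ⟨f v - n, List.mem_range.2 (by omega), ?_⟩
        rw [Nat.add_sub_cancel' h1, h2]
    refine ⟨n + d, by omega, ?_⟩
    have e : (List.range (n + d)).map ρ = (List.range n).map ρ ++ l := by
      simp [l, List.range_add, Function.comp_def]
    have := scoreState_lt_append ((List.range n).map ρ).reverse l.reverse
      ((occ_reverse l).trans hocc) (by simp [l, d])
    rw [score_eq_scoreState] at hk ⊢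
    rw [e, List.reverse_append]
    omega

end Score

section Plays

theorem prefix_map_range_eq {ρ : ℕ → V} {n : ℕ} {w : List V}
    (h : w <+: (List.range n).map ρ) : w = (List.range w.length).map ρ := by
  have hl : w.length ≤ n := by simpa using h.length_le
  have := List.prefix_iff_eq_take.1 h
  rw [← List.map_take, List.take_range, min_eq_left hl] at this
  exact this

theorem append_pair_prefix_eq {ρ : ℕ → V} {n : ℕ} {u : List V} {v x : V}
    (h : u ++ [v, x] <+: (List.range n).map ρ) :
    u = (List.range u.length).map ρ ∧ v = ρ u.length ∧ x = ρ (u.length + 1) := by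
  have h := prefix_map_range_eq h
  rw [List.length_append, List.length_cons, List.length_singleton,
    show u.length + (1 + 1) = u.length + 1 + 1 from rfl, List.range_succ, List.range_succ,
    List.map_append, List.map_append, List.append_assoc] at h
  obtain ⟨h1, h2⟩ := List.append_inj h (by simp)
  exact ⟨h1, by simpa using h2⟩

variable {G : Arena V} {v : V} {ρ : ℕ → V}

theorem Arena.IsPlay.isChain (h : G.IsPlay v ρ) (n : ℕ) :
    ((List.range n).map ρ).IsChain G.E := by
  refine List.isChain_iff_forall_rel_of_append_cons_cons.2 fun {a b l₁ l₂} e => ?_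
  obtain ⟨_, rfl, rfl⟩ := append_pair_prefix_eq (ρ := ρ) (n := n) (u := l₁) (v := a) (x := b)
    ⟨l₂, by simp [e]⟩
  exact h.2 _

theorem Arena.IsPlay.head? (h : G.IsPlay v ρ) (n : ℕ) :
    ((List.range (n + 1)).map ρ).head? = some v := by
  simp [List.range_succ_eq_map, h.1]

theorem Arena.ConsistentInf.fin {i : Fin 2} {σ : Strategy V} (h : G.ConsistentInf i σ ρ) (n : ℕ) :
    G.ConsistentFin i σ ((List.range n).map ρ) := by
  intro u v x hp hv
  obtain ⟨hu, rfl, rfl⟩ := append_pair_prefix_eq hp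
  rw [h _ hv, ← hu]

theorem pos_compl (G : Arena V) {i j : Fin 2} (hij : i ≠ j) : G.pos j = (G.pos i)ᶜ := by
  fin_cases i <;> fin_cases j <;> simp_all [Arena.pos]

theorem exists_play_consistent {i j : Fin 2} (hij : i ≠ j) {σ τ : Strategy V} (hσ : G.Legal σ)
    (hτ : G.Legal τ) (v : V) :
    ∃ ρ, G.IsPlay v ρ ∧ G.ConsistentInf i σ ρ ∧ G.ConsistentInf j τ ρ := by
  classical
  let next (p : List V × V) : V := if p.2 ∈ G.pos i then σ p.1 p.2 else τ p.1 p.2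
  let hist : ℕ → List V × V := fun n =>
    Nat.rec ([], v) (fun _ p => (p.1 ++ [p.2], next p)) n
  have hfst : ∀ n, (hist n).1 = (List.range n).map fun n => (hist n).2 := by
    intro n
    induction n with
    | zero => rfl
    | succ n ih =>
      rw [List.range_succ, List.map_append, ← ih]
      rfl
  refine ⟨fun n => (hist n).2, ⟨rfl, fun n => ?_⟩, fun n hn => ?_, fun n hn => ?_⟩
  · change G.E _ (next (hist n))
    unfold next
    split_ifs
    · exact hσ _ _
    · exact hτ _ _
  · change next (hist n) = _
    rw [← hfst]
    exact if_pos hn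
  · change next (hist n) = _
    rw [← hfst]
    rw [pos_compl G hij] at hn
    exact if_neg hn

/-- Player `i` has a strategy bounding the scores of the sets outside `𝓕` by two. -/
def BoundsFrom (G : Arena V) (i : Fin 2) (𝓕 : Set (Set V)) (v : V) : Prop :=
  ∃ σ : Strategy V, G.Legal σ ∧ ∀ w : List V, w.IsChain G.E → w.head? = some v →
    G.ConsistentFin i σ w → ∀ F ∉ 𝓕, score F w ≤ 2

theorem boundsFrom_of_good {i : Fin 2} {𝓕 : Set (Set V)} {D : Set V}
    (hD : Good G.E (G.pos i) 𝓕ᶜ D ∅) (htrap : ∀ v ∈ D, v ∉ G.pos i → ∀ u, G.E v u → u ∈ D)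
    (hv : v ∈ D) : BoundsFrom G i 𝓕 v := by
  classical
  let σ : Strategy V := fun u y =>
    if h : ∃ x, G.E y x ∧ Safe G.E (G.pos i) 𝓕ᶜ D ∅ (x :: y :: u.reverse) then h.choose
    else (G.exists_succ y).choose
  refine ⟨σ, fun u y => ?_, ?_⟩
  · unfold σ
    split_ifs with h
    · exact h.choose_spec.1
    · exact (G.exists_succ y).choose_spec
  have fresh : ∀ F : Set V, Fresh (scoreState F [v]) := fun F => fresh_step_zero F v rfl
  have key : ∀ u y, (u ++ [y]).IsChain G.E → (u ++ [y]).head? = some v →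
      G.ConsistentFin i σ (u ++ [y]) →
      Safe G.E (G.pos i) 𝓕ᶜ D ∅ (y :: u.reverse) ∧
        ∀ F, ¬ F ⊆ D → Capped 0 D F (scoreState F (y :: u.reverse)) := by
    intro u
    induction u using List.reverseRecOn with
    | nil =>
      intro y _ hh _
      obtain rfl : y = v := by simpa using hh
      exact ⟨hD y hv [] fun F _ _ => fresh F, fun F hF => (fresh F).capped hF⟩
    | append_singleton u z ih =>
      intro y hc hh hcon
      have hpre : u ++ [z] <+: u ++ [z] ++ [y] := List.prefix_append _ _
      obtain ⟨hs, hcap⟩ := ih z hc.left_of_append (by simpa using hh)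
        fun a b c h => hcon a b c (h.trans hpre)
      have hE : G.E z y := List.isChain_iff_forall_rel_of_append_cons_cons.1 hc
        (l₁ := u) (l₂ := []) (by simp)
      obtain ⟨hz, _, h3, h4⟩ := hs.unfold
      have hsafe : Safe G.E (G.pos i) 𝓕ᶜ D ∅ (y :: z :: u.reverse) := by
        by_cases hp : z ∈ G.pos i
        · have hy : y = σ u z := hcon u z y (by simp) hp
          have hex : ∃ x, G.E z x ∧ Safe G.E (G.pos i) 𝓕ᶜ D ∅ (x :: z :: u.reverse) := by
            obtain ⟨x, hx, h⟩ := h3 hp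
            exact ⟨x, hx, h.resolve_left (Set.notMem_empty x)⟩
          rw [hy]
          unfold σ
          rw [dif_pos hex]
          exact hex.choose_spec.2
        · exact (h4 hp y (Or.inl (htrap z hz hp y hE)) hE).resolve_left (Set.notMem_empty y)
      rw [List.reverse_append, List.reverse_singleton, List.singleton_append]
      exact ⟨hsafe, fun F hF => (hcap F hF).step hF hsafe.unfold.1⟩
  intro w hc hh hcon F hF
  rcases w.eq_nil_or_concat with rfl | ⟨u, y, rfl⟩
  · rw [score_nil]; norm_num
  · rw [List.concat_eq_append] at hc hh hcon ⊢
    obtain ⟨hs, hcap⟩ := key u y hc hh hcon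
    rw [score_eq_scoreState, List.reverse_append, List.reverse_singleton, List.singleton_append]
    by_cases hFD : F ⊆ D
    · exact hs.unfold.2.1 F hF hFD
    · exact (hcap F hFD).le.trans (by norm_num)

theorem boundsFrom_or [Finite V] (G : Arena V) {F0 F1 : Set (Set V)}
    (hpart : F0 ∪ F1 = Set.univ) (v : V) : BoundsFrom G 0 F0 v ∨ BoundsFrom G 1 F1 v := by
  have hO : Disjoint F0ᶜ F1ᶜ := by
    rw [Set.disjoint_compl_left_iff_subset, Set.compl_subset_iff_union, Set.union_comm, hpart]
  have hpos : (G.pos 0)ᶜ = G.pos 1 := (pos_compl G (by decide)).symm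
  obtain ⟨D, D', h1, h2, h3, h4, h5⟩ := split_of_disjoint (E := G.E) (P := G.pos 0) hO Set.univ
    fun v _ => (G.exists_succ v).imp fun u h => ⟨Set.mem_univ u, h⟩
  rw [hpos] at h3
  rcases (h1 ▸ Set.mem_univ v : v ∈ D ∪ D') with hv | hv
  · exact Or.inl (boundsFrom_of_good h2 (fun v hv hp u he => h4 v hv hp u (Set.mem_univ u) he) hv)
  · refine Or.inr (boundsFrom_of_good h3 (fun v hv hp u he => ?_) hv)
    exact h5 v hv (by rwa [← hpos, Set.mem_compl_iff, not_not] at hp) u (Set.mem_univ u) he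

theorem limitSet_mem_of_scores_le [Finite V] {𝓕 : Set (Set V)} (hp : G.IsPlay v ρ) {i : Fin 2}
    {σ : Strategy V} (hσ : ∀ w : List V, w.IsChain G.E → w.head? = some v →
      G.ConsistentFin i σ w → ∀ F ∉ 𝓕, score F w ≤ 2) (hc : G.ConsistentInf i σ ρ) :
    limitSet ρ ∈ 𝓕 := by
  by_contra hF
  obtain ⟨n, hn⟩ := exists_le_score_limitSet ρ 3
  cases n with
  | zero => simp [score_nil] at hn
  | succ n => exact absurd (hσ _ (hp.isChain _) (hp.head? n) (hc.fin _) _ hF) (by omega)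

theorem BoundsFrom.mullerWinFrom [Finite V] {i : Fin 2} {𝓕 : Set (Set V)}
    (h : BoundsFrom G i 𝓕 v) : G.MullerWinFrom i 𝓕 v := by
  obtain ⟨σ, hl, hσ⟩ := h
  exact ⟨σ, hl, fun ρ hp hc => limitSet_mem_of_scores_le hp hσ hc⟩

theorem BoundsFrom.ftWinFrom {i : Fin 2} {𝓕 : Set (Set V)} (h : BoundsFrom G i 𝓕 v) :
    FTWinFrom G i 𝓕 3 v := by
  obtain ⟨σ, hl, hσ⟩ := h
  refine ⟨σ, hl, fun w ⟨hw, hmax, hlast⟩ hh hc => ?_⟩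
  have hpos : 0 < maxscore Set.univ w := by rw [hmax]; norm_num
  obtain ⟨F, -, u, hu, hpre, he⟩ := exists_score_eq_maxscore hpos
  obtain rfl : u = w := by
    by_contra hne
    have hpre' : u <+: w.dropLast := by
      obtain ⟨t, rfl⟩ := hpre
      have ht : t ≠ [] := by rintro rfl; simp at hne
      rw [List.dropLast_append_of_ne_nil ht]
      exact List.prefix_append _ _
    have := score_le_maxscore (Set.mem_univ F) hu hpre'
    omega
  refine ⟨F, by_contra fun hF => ?_, by rw [← he, hmax]⟩
  have := hσ u hw hh hc F hF
  omega

theorem BoundsFrom.not_mullerWinFrom [Finite V] {i j : Fin 2} (hij : i ≠ j) {𝓕 𝓕' : Set (Set V)}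
    (hd : Disjoint 𝓕 𝓕') (h : BoundsFrom G i 𝓕 v) : ¬ G.MullerWinFrom j 𝓕' v := by
  rintro ⟨τ, hτl, hτ⟩
  obtain ⟨σ, hl, hσ⟩ := h
  obtain ⟨ρ, hp, hi, hj⟩ := exists_play_consistent hij hl hτl v
  exact Set.disjoint_left.1 hd (limitSet_mem_of_scores_le hp hσ hi) (hτ ρ hp hj)

/-- Every infinite play has a prefix that is a play of the finite-time game with threshold three. -/
theorem Arena.IsPlay.exists_ftPlay [Finite V] (hp : G.IsPlay v ρ) :
    ∃ n, FTPlay G 3 ((List.range (n + 1)).map ρ) := by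
  classical
  have hex : ∃ n, ∃ F, 3 ≤ score F ((List.range n).map ρ) :=
    (exists_le_score_limitSet ρ 3).imp fun n h => ⟨_, h⟩
  obtain ⟨n, ⟨F, hF⟩, hmin⟩ : ∃ n, (∃ F, 3 ≤ score F ((List.range n).map ρ)) ∧
      ∀ m < n, ∀ F, score F ((List.range m).map ρ) ≤ 2 :=
    ⟨Nat.find hex, Nat.find_spec hex, fun m hm F =>
      not_lt.1 fun h => Nat.find_min hex hm ⟨F, h⟩⟩
  cases n with
  | zero => simp [score_nil] at hF
  | succ n =>
    have hsucc : (List.range (n + 1)).map ρ = (List.range n).map ρ ++ [ρ n] := by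
      simp [List.range_succ]
    refine ⟨n, hp.isChain _, le_antisymm (maxscore_le fun F' _ u hu => ?_) ?_, ?_⟩
    · have hlen : u.length ≤ n + 1 := by simpa using hu.length_le
      rw [prefix_map_range_eq hu]
      rcases hlen.lt_or_eq with h | h
      · exact (hmin _ h F').trans (by norm_num)
      · rw [h, hsucc]
        have := score_append_singleton_le F' ((List.range n).map ρ) (ρ n)
        have := hmin n n.lt_succ_self F'
        omega
    · exact hF.trans (score_le_maxscore (Set.mem_univ F) (by simp) List.prefix_rfl)
    · rw [hsucc, List.dropLast_concat]
      refine Nat.lt_succ_of_le (maxscore_le fun F' _ u hu => ?_)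
      have hlen : u.length ≤ n := by simpa using hu.length_le
      rw [prefix_map_range_eq hu]
      exact hmin _ (by omega) F'

theorem BoundsFrom.not_ftWinFrom [Finite V] {i j : Fin 2} (hij : i ≠ j) {𝓕 𝓕' : Set (Set V)}
    (hd : Disjoint 𝓕 𝓕') (h : BoundsFrom G i 𝓕 v) : ¬ FTWinFrom G j 𝓕' 3 v := by
  rintro ⟨τ, hτl, hτ⟩
  obtain ⟨σ, hl, hσ⟩ := h
  obtain ⟨ρ, hp, hi, hj⟩ := exists_play_consistent hij hl hτl v
  obtain ⟨n, hn⟩ := hp.exists_ftPlay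
  obtain ⟨F, hF, hs⟩ := hτ _ hn (hp.head? n) (hj.fin _)
  have := hσ _ (hp.isChain _) (hp.head? n) (hi.fin _) F fun h => Set.disjoint_left.1 hd h hF
  omega

theorem mullerWinFrom_iff_ftWinFrom [Finite V] {i j : Fin 2} (hij : i ≠ j) {𝓕 𝓕' : Set (Set V)}
    (hd : Disjoint 𝓕 𝓕') (h : BoundsFrom G i 𝓕 v ∨ BoundsFrom G j 𝓕' v) :
    G.MullerWinFrom i 𝓕 v ↔ FTWinFrom G i 𝓕 3 v := by
  rcases h with h | h
  · exact iff_of_true h.mullerWinFrom h.ftWinFrom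
  · exact iff_of_false (h.not_mullerWinFrom hij.symm hd.symm) (h.not_ftWinFrom hij.symm hd.symm)

end Plays

/-- The winning regions of the Muller game `(G, 𝓕₀, 𝓕₁)`
coincide with the winning regions of the finite-time Muller game
`(G, 𝓕₀, 𝓕₁, 3)` with threshold `3`. -/
theorem stmt_11 {V : Type u} [Fintype V] (G : Arena V)
    (F0 F1 : Set (Set V)) (hpart : F0 ∪ F1 = Set.univ) (hdisj : Disjoint F0 F1) :
    G.MullerWinRegion 0 F0 = FTWinRegion G 0 F0 3 ∧
      G.MullerWinRegion 1 F1 = FTWinRegion G 1 F1 3 := by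
  refine ⟨Set.ext fun v => ?_, Set.ext fun v => ?_⟩
  · exact mullerWinFrom_iff_ftWinFrom (by decide) hdisj (boundsFrom_or G hpart v)
  · exact mullerWinFrom_iff_ftWinFrom (by decide) hdisj.symm (boundsFrom_or G hpart v).symm
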